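/- arXiv:1312.6711 — 2 statements merged into one kernel-verified Lean document; each statement's English description precedes it below -/
import Mathlib

section
/- Let $k$ be a local field (complete discrete valuation field with finite residue field) and $\mathcal{A}$ a Banach $k$-algebra with $\|\mathcal{A}\| \subseteq |k|$. Let $O \subseteq \mathcal{A}(1)$ be a closed $k^{\circ}$-subring. If a central idempotent $\bar{e} \in \overline{\mathcal{A}}$ lies in the image of $O$ under the reduction map, then there exists a central idempotent $e \in \mathcal{A}$ with $e \in O$ and $e + \mathcal{A}(1-) = \bar{e}$. -/
theorem cil_step {A : Type*} [NormedRing A] (O : Subring A) (hO1 : ∀ x ∈ O, ‖x‖ ≤ 1)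
    (x : A) (hx : x ∈ O) : ∃ z ∈ O, ‖z - x‖ ≤ ‖x * x - x‖ ∧
      ‖z * z - z‖ ≤ ‖x * x - x‖ * ‖x * x - x‖ := by
  have h1 := O.one_mem
  have h2 : x + x ∈ O := O.add_mem hx hx
  have hy : x * x - x ∈ O := O.sub_mem (O.mul_mem hx hx) hx
  have hu : 1 - (x + x) ∈ O := O.sub_mem h1 h2
  refine ⟨x + (x * x - x) * (1 - (x + x)), O.add_mem hx (O.mul_mem hy hu), ?_, ?_⟩
  · rw [add_sub_cancel_left]
    calc _ ≤ ‖x * x - x‖ * ‖1 - (x + x)‖ := norm_mul_le _ _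
      _ ≤ _ := mul_le_of_le_one_right (norm_nonneg _) (hO1 _ hu)
  · have hv : 4 * (x * x - x) - 3 ∈ O :=
      O.sub_mem (O.mul_mem (by exact_mod_cast natCast_mem O 4) hy) (by exact_mod_cast natCast_mem O 3)
    have : (x + (x * x - x) * (1 - (x + x))) * (x + (x * x - x) * (1 - (x + x))) -
        (x + (x * x - x) * (1 - (x + x))) =
        (x * x - x) * (x * x - x) * (4 * (x * x - x) - 3) := by noncomm_ring
    rw [this]
    calc _ ≤ ‖(x * x - x) * (x * x - x)‖ * ‖4 * (x * x - x) - 3‖ := norm_mul_le _ _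
      _ ≤ ‖(x * x - x) * (x * x - x)‖ := mul_le_of_le_one_right (norm_nonneg _) (hO1 _ hv)
      _ ≤ _ := norm_mul_le _ _

/-- Lifting of central idempotents inside a closed integral subring: let `k` be a local
field (complete, nonarchimedean, discretely valued with uniformizer `ϖ`, locally compact)
and `𝒜` a Banach `k`-algebra with `‖𝒜‖ ⊆ |k|`. Let `O ⊆ 𝒜(1)` be a closed
`k°`-subring. If a central idempotent of the residue algebra lies in the image of `O`
(i.e. has a lift `a ∈ O` with `‖a² - a‖ < 1` and `‖ab - ba‖ < 1` for all `b ∈ 𝒜(1)`),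
then there is a central idempotent `e ∈ O` of `𝒜` with the same reduction. -/
theorem central_idempotent_lift {k A : Type*} [NontriviallyNormedField k] [CompleteSpace k]
    [IsUltrametricDist k] [ProperSpace k]
    (ϖ : k) (hϖ0 : 0 < ‖ϖ‖) (hϖ1 : ‖ϖ‖ < 1)
    (hdisc : ∀ x : k, x ≠ 0 → ∃ n : ℤ, ‖x‖ = ‖ϖ‖ ^ n)
    [NormedRing A] [NormOneClass A] [IsUltrametricDist A] [CompleteSpace A]
    [NormedAlgebra k A]
    (hval : ∀ a : A, ∃ c : k, ‖a‖ = ‖c‖)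
    (O : Subring A) (hO1 : ∀ x ∈ O, ‖x‖ ≤ 1) (hOclosed : IsClosed (O : Set A))
    (hOsmul : ∀ c : k, ‖c‖ ≤ 1 → ∀ x ∈ O, c • x ∈ O)
    (a : A) (haO : a ∈ O) (hid : ‖a * a - a‖ < 1)
    (hcent : ∀ b : A, ‖b‖ ≤ 1 → ‖a * b - b * a‖ < 1) :
    ∃ e ∈ O, e * e = e ∧ (∀ b : A, e * b = b * e) ∧ ‖e - a‖ < 1 := by
  classical
  obtain ⟨δ, hδ⟩ : ∃ δ, δ = ‖a * a - a‖ := ⟨_, rfl⟩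
  rw [← hδ] at hid
  have hδ0 : 0 ≤ δ := hδ ▸ norm_nonneg _
  choose f hfO hf1 hf2 using cil_step O hO1
  let g : O → O := fun x => ⟨f x x.2, hfO x x.2⟩
  let s : ℕ → O := fun n => g^[n] ⟨a, haO⟩
  have hs : ∀ n, s (n + 1) = g (s n) := fun n => Function.iterate_succ_apply' g n _
  have hd : ∀ n, ‖(s n : A) * s n - s n‖ ≤ δ * δ ^ n := by
    intro n
    induction n with
    | zero => simp [s, hδ]
    | succ n ih =>
      rw [hs]
      have hle : δ * δ ^ n ≤ δ := mul_le_of_le_one_right hδ0 (pow_le_one₀ hδ0 hid.le)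
      calc _ ≤ _ := hf2 (s n) (s n).2
        _ ≤ (δ * δ ^ n) * δ := mul_le_mul ih (ih.trans hle) (norm_nonneg _) (by positivity)
        _ = _ := by ring
  have hstep : ∀ n, ‖(s (n + 1) : A) - s n‖ ≤ δ * δ ^ n := by
    intro n
    rw [hs]
    exact (hf1 (s n) (s n).2).trans (hd n)
  have hc : CauchySeq (fun n => (s n : A)) := by
    refine cauchySeq_of_le_geometric δ δ hid (fun n => ?_)
    rw [dist_comm, dist_eq_norm]
    exact hstep n
  obtain ⟨e, he⟩ := cauchySeq_tendsto_of_complete hc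
  have heO : e ∈ O := hOclosed.mem_of_tendsto he (Filter.Eventually.of_forall fun n => (s n).2)
  have hee : e * e = e := by
    have h1 := ((he.mul he).sub he).norm
    have h2 : Filter.Tendsto (fun n : ℕ => δ * δ ^ n) Filter.atTop (nhds 0) := by
      simpa using (tendsto_pow_atTop_nhds_zero_of_lt_one hδ0 hid).const_mul δ
    have h3 := le_of_tendsto_of_tendsto' h1 h2 hd
    exact sub_eq_zero.mp (norm_le_zero_iff.mp h3)
  have hclose : ∀ n, ‖(s n : A) - a‖ ≤ δ := by
    intro n
    induction n with
    | zero => simpa [s] using hδ0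
    | succ n ih =>
      have := IsUltrametricDist.norm_add_le_max ((s (n + 1) : A) - s n) (s n - a)
      rw [sub_add_sub_cancel] at this
      refine this.trans (max_le ((hstep n).trans ?_) ih)
      exact mul_le_of_le_one_right hδ0 (pow_le_one₀ hδ0 hid.le)
  have hea : ‖e - a‖ < 1 :=
    (le_of_tendsto' (he.sub_const a).norm hclose).trans_lt hid
  have hcomm : ∀ b : A, ‖b‖ ≤ 1 → ‖e * b - b * e‖ < 1 := by
    intro b hb
    have h1 : ‖(e - a) * b‖ < 1 := (norm_mul_le _ _).trans_lt
      ((mul_le_of_le_one_right (norm_nonneg _) hb).trans_lt hea)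
    have h2 : ‖b * (e - a)‖ < 1 := (norm_mul_le _ _).trans_lt
      ((mul_le_of_le_one_left (norm_nonneg _) hb).trans_lt hea)
    have : e * b - b * e = (a * b - b * a) + ((e - a) * b + -(b * (e - a))) := by noncomm_ring
    rw [this]
    refine (IsUltrametricDist.norm_add_le_max _ _).trans_lt (max_lt (hcent b hb) ?_)
    refine (IsUltrametricDist.norm_add_le_max _ _).trans_lt (max_lt h1 ?_)
    rwa [norm_neg]
  have key : ∀ x : A, ‖e * x - x * e‖ = ‖x‖ → x = 0 := by
    intro x hx
    by_contra hne
    obtain ⟨c, hc⟩ := hval x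
    have hxn : ‖x‖ ≠ 0 := norm_ne_zero_iff.mpr hne
    have h1 : ‖c⁻¹ • x‖ = 1 := by rw [norm_smul, norm_inv, ← hc, inv_mul_cancel₀ hxn]
    have h2 := hcomm (c⁻¹ • x) h1.le
    rw [mul_smul_comm, smul_mul_assoc, ← smul_sub, norm_smul, hx, ← norm_smul, h1] at h2
    exact lt_irrefl _ h2
  refine ⟨e, heO, hee, fun b => ?_, hea⟩
  have k1 : e * b - e * b * e = 0 := by
    apply key
    congr 1
    have : e * (e * b - e * b * e) - (e * b - e * b * e) * e =
      (e * e) * b - (e * e) * b * e - e * b * e + e * b * (e * e) := by noncomm_ring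
    rw [this, hee]; noncomm_ring
  have k2 : b * e - e * b * e = 0 := by
    apply key
    rw [← norm_neg]
    congr 1
    have : -(e * (b * e - e * b * e) - (b * e - e * b * e) * e) =
      (e * e) * b * e - e * b * e + b * (e * e) - e * b * (e * e) := by noncomm_ring
    rw [this, hee]; noncomm_ring
  rw [sub_eq_zero.mp k1, sub_eq_zero.mp k2]
end

section
/- Let $k$ be a local field and $\mathcal{A}$ a Banach $k$-algebra with $\|\mathcal{A}\| = |k|$. If the residue algebra $\overline{\mathcal{A}} = \mathcal{A}(1)/\mathcal{A}(1-)$ is a finite dimensional simple $\bar{k}$-algebra, then the underlying $k$-algebra of $\mathcal{A}$ is a finite dimensional simple $k$-algebra. -/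
instance instSubtypeUltrametric {α : Type*} [PseudoMetricSpace α] [IsUltrametricDist α]
    {p : α → Prop} : IsUltrametricDist (Subtype p) :=
  ⟨fun x y z => IsUltrametricDist.dist_triangle_max x.1 y.1 z.1⟩

/-- The closed unit ball of an ultrametric normed ring, as a subring. -/
def unitBall (A : Type*) [NormedRing A] [NormOneClass A] [IsUltrametricDist A] : Subring A where
  carrier := {a | ‖a‖ ≤ 1}
  mul_mem' {a b} ha hb := le_trans (norm_mul_le a b) (mul_le_one₀ ha (norm_nonneg b) hb)
  one_mem' := le_of_eq norm_one
  add_mem' {a b} ha hb := le_trans (IsUltrametricDist.norm_add_le_max a b) (max_le ha hb)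
  zero_mem' := by simp
  neg_mem' {a} ha := by simpa using ha

/-- The congruence relation on the unit ball identifying elements whose difference has
norm `< 1`. -/
def redCon (A : Type*) [NormedRing A] [NormOneClass A] [IsUltrametricDist A] :
    RingCon (unitBall A) where
  r a b := ‖(a : A) - (b : A)‖ < 1
  iseqv := by
    refine ⟨fun a => by simp, fun {a b} h => ?_, fun {a b c} h1 h2 => ?_⟩
    · rwa [norm_sub_rev]
    · have : (a : A) - c = ((a : A) - b) + ((b : A) - c) := by abel
      rw [this]
      exact lt_of_le_of_lt (IsUltrametricDist.norm_add_le_max _ _) (max_lt h1 h2)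
  mul' {w x y z} h1 h2 := by
    have key : ((w * y : unitBall A) : A) - ((x * z : unitBall A) : A)
        = (w : A) * ((y : A) - (z : A)) + ((w : A) - (x : A)) * (z : A) := by
      push_cast; rw [mul_sub, sub_mul]; abel
    show ‖((w * y : unitBall A) : A) - ((x * z : unitBall A) : A)‖ < 1
    rw [key]
    refine lt_of_le_of_lt (IsUltrametricDist.norm_add_le_max _ _) (max_lt ?_ ?_)
    · exact lt_of_le_of_lt (norm_mul_le _ _)
        (lt_of_le_of_lt (mul_le_of_le_one_left (norm_nonneg _) w.2) h2)
    · exact lt_of_le_of_lt (norm_mul_le _ _)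
        (lt_of_le_of_lt (mul_le_of_le_one_right (norm_nonneg _) z.2) h1)
  add' {w x y z} h1 h2 := by
    have key : ((w + y : unitBall A) : A) - ((x + z : unitBall A) : A)
        = ((w : A) - (x : A)) + ((y : A) - (z : A)) := by push_cast; abel
    show ‖((w + y : unitBall A) : A) - ((x + z : unitBall A) : A)‖ < 1
    rw [key]
    exact lt_of_le_of_lt (IsUltrametricDist.norm_add_le_max _ _) (max_lt h1 h2)

/-- The residue ring `𝒜(1)/𝒜(1-)` of an ultrametric normed ring. -/
abbrev Red (A : Type*) [NormedRing A] [NormOneClass A] [IsUltrametricDist A] : Type _ :=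
  (redCon A).Quotient


/-- reduction map -/
def redMk (A : Type*) [NormedRing A] [NormOneClass A] [IsUltrametricDist A] :
    unitBall A →+* Red A := (redCon A).mk'

theorem redMk_eq {A : Type*} [NormedRing A] [NormOneClass A] [IsUltrametricDist A]
    (a b : unitBall A) : redMk A a = redMk A b ↔ ‖(a : A) - (b : A)‖ < 1 :=
  (redCon A).eq

theorem redMk_surj {A : Type*} [NormedRing A] [NormOneClass A] [IsUltrametricDist A] :
    Function.Surjective (redMk A) := (redCon A).mk'_surjective

/-- image of a two-sided ideal in the reduction -/
def redIdeal {A : Type*} [NormedRing A] [NormOneClass A] [IsUltrametricDist A]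
    (I : TwoSidedIdeal A) : TwoSidedIdeal (Red A) :=
  TwoSidedIdeal.mk' {x | ∃ a : unitBall A, (a : A) ∈ I ∧ redMk A a = x}
    ⟨0, by simpa using I.zero_mem, map_zero _⟩
    (by
      rintro _ _ ⟨a, ha, rfl⟩ ⟨b, hb, rfl⟩
      exact ⟨a + b, by simpa using I.add_mem ha hb, map_add _ _ _⟩)
    (by
      rintro _ ⟨a, ha, rfl⟩
      exact ⟨-a, by simpa using I.neg_mem ha, map_neg _ _⟩)
    (by
      rintro x _ ⟨b, hb, rfl⟩
      obtain ⟨a, rfl⟩ := redMk_surj x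
      exact ⟨a * b, by simpa using I.mul_mem_left _ _ hb, map_mul _ _ _⟩)
    (by
      rintro _ y ⟨b, hb, rfl⟩
      obtain ⟨a, rfl⟩ := redMk_surj y
      exact ⟨b * a, by simpa using I.mul_mem_right _ _ hb, map_mul _ _ _⟩)

theorem mem_redIdeal {A : Type*} [NormedRing A] [NormOneClass A] [IsUltrametricDist A]
    (I : TwoSidedIdeal A) (x : Red A) :
    x ∈ redIdeal I ↔ ∃ a : unitBall A, (a : A) ∈ I ∧ redMk A a = x := by
  unfold redIdeal
  rw [TwoSidedIdeal.mem_mk']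
  rfl

/-- Theorem (simplicity): let `k` be a local field and `𝒜` a Banach `k`-algebra with
`‖𝒜‖ = |k|`. If the residue algebra `𝒜(1)/𝒜(1-)` is a finite dimensional (equivalently,
since the residue field of `k` is finite, a finite) simple ring, then `𝒜` is a finite
dimensional simple `k`-algebra. -/
theorem simple_of_simple_reduction {k A : Type*} [NontriviallyNormedField k] [CompleteSpace k]
    [IsUltrametricDist k] [ProperSpace k]
    (ϖ : k) (hϖ0 : 0 < ‖ϖ‖) (hϖ1 : ‖ϖ‖ < 1)
    (hdisc : ∀ x : k, x ≠ 0 → ∃ n : ℤ, ‖x‖ = ‖ϖ‖ ^ n)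
    [NormedRing A] [NormOneClass A] [IsUltrametricDist A] [CompleteSpace A]
    [NormedAlgebra k A]
    (hval : ∀ a : A, ∃ c : k, ‖a‖ = ‖c‖) (hval' : ∀ c : k, ∃ a : A, ‖a‖ = ‖c‖)
    (hfin : Finite (Red A)) (hsimple : IsSimpleRing (Red A)) :
    IsSimpleRing A ∧ FiniteDimensional k A := by
  have hϖ : ϖ ≠ 0 := norm_pos_iff.1 hϖ0
  constructor
  · haveI : Nontrivial A := NormOneClass.nontrivial
    refine ⟨⟨fun I => ?_⟩⟩
    by_cases hI : I = ⊥
    · exact Or.inl hI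
    right
    obtain ⟨a, haI, ha0⟩ : ∃ a ∈ I, a ≠ 0 := by
      by_contra! h
      exact hI (le_bot_iff.1 fun x hx => (TwoSidedIdeal.mem_bot A).2 (h x hx))
    obtain ⟨c, hc⟩ := hval a
    have hc0 : ‖c‖ ≠ 0 := by rw [← hc]; exact norm_ne_zero_iff.2 ha0
    have hbn : ‖c⁻¹ • a‖ = 1 := by
      rw [norm_smul, norm_inv, hc, inv_mul_cancel₀ hc0]
    have hbI : c⁻¹ • a ∈ I := by
      rw [← one_mul a, ← smul_mul_assoc]
      exact I.mul_mem_left _ _ haI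
    let b : unitBall A := ⟨c⁻¹ • a, hbn.le⟩
    have hJ : redIdeal I = ⊤ := by
      refine (eq_bot_or_eq_top (redIdeal I)).resolve_left fun h => ?_
      have h1 : redMk A b ∈ redIdeal I := (mem_redIdeal I _).2 ⟨b, hbI, rfl⟩
      rw [h, TwoSidedIdeal.mem_bot, ← map_zero (redMk A), redMk_eq] at h1
      simp [b, hbn] at h1
    have h1 : (1 : Red A) ∈ redIdeal I := by rw [hJ]; trivial
    obtain ⟨u, huI, hu⟩ := (mem_redIdeal I _).1 h1
    rw [← map_one (redMk A), redMk_eq] at hu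
    have hu' : IsUnit (u : A) := by
      have := isUnit_one_sub_of_norm_lt_one (x := 1 - (u : A)) (by
        rw [norm_sub_rev]; simpa using hu)
      simpa using this
    obtain ⟨v, hv⟩ := hu'.exists_left_inv
    refine (TwoSidedIdeal.one_mem_iff I).1 ?_
    rw [← hv]
    exact I.mul_mem_left _ _ huI
  · have hlt : ∀ a : A, ‖a‖ < 1 → ‖a‖ ≤ ‖ϖ‖ := by
      intro a ha
      obtain ⟨c, hc⟩ := hval a
      by_cases h0 : c = 0
      · rw [hc, h0, norm_zero]; exact hϖ0.le
      obtain ⟨n, hn⟩ := hdisc c h0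
      rw [hc, hn] at ha ⊢
      have : 0 < n := by
        by_contra! h
        exact absurd ha (not_lt.2 (one_le_zpow_of_nonpos₀ hϖ0 hϖ1.le h))
      calc ‖ϖ‖ ^ n ≤ ‖ϖ‖ ^ (1 : ℤ) := zpow_le_zpow_right_of_le_one₀ hϖ0 hϖ1.le this
        _ = ‖ϖ‖ := zpow_one _
    choose s hs using (redMk_surj (A := A))
    let F : Submodule k A := Submodule.span k (Set.range fun x => (s x : A))
    haveI : FiniteDimensional k F := FiniteDimensional.span_of_finite k (Set.finite_range _)
    have happ : ∀ n : ℕ, ∀ a : A, ‖a‖ ≤ 1 → ∃ f ∈ F, ‖a - f‖ ≤ ‖ϖ‖ ^ n := by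
      intro n
      induction n with
      | zero => intro a ha; exact ⟨0, F.zero_mem, by simpa using ha⟩
      | succ n ih =>
        intro a ha
        obtain ⟨f, hf, hfa⟩ := ih a ha
        have hp : 0 < ‖ϖ‖ ^ n := pow_pos hϖ0 n
        let b : unitBall A := ⟨(ϖ ^ n)⁻¹ • (a - f), by
          change ‖(ϖ ^ n)⁻¹ • (a - f)‖ ≤ 1
          rw [norm_smul, norm_inv, norm_pow]
          exact inv_mul_le_one_of_le₀ hfa hp.le⟩
        have h1 : ‖(b : A) - (s (redMk A b) : A)‖ < 1 := (redMk_eq _ _).1 (hs _).symm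
        refine ⟨f + ϖ ^ n • (s (redMk A b) : A), F.add_mem hf
          (F.smul_mem _ (Submodule.subset_span ⟨_, rfl⟩)), ?_⟩
        have : a - (f + ϖ ^ n • (s (redMk A b) : A))
            = ϖ ^ n • ((b : A) - (s (redMk A b) : A)) := by
          rw [smul_sub]
          simp only [b]
          rw [smul_inv_smul₀ (pow_ne_zero n hϖ)]
          abel
        rw [this, norm_smul, norm_pow, pow_succ]
        exact mul_le_mul_of_nonneg_left (hlt _ h1) hp.le
    have hball : ∀ a : A, ‖a‖ ≤ 1 → a ∈ F := by
      intro a ha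
      have hcl : IsClosed (F : Set A) := F.closed_of_finiteDimensional
      change a ∈ (F : Set A)
      rw [← hcl.closure_eq, Metric.mem_closure_iff]
      intro ε hε
      obtain ⟨n, hn⟩ := exists_pow_lt_of_lt_one hε hϖ1
      obtain ⟨f, hf, hfa⟩ := happ n a ha
      exact ⟨f, hf, by rw [dist_eq_norm]; exact hfa.trans_lt hn⟩
    have htop : F = ⊤ := by
      rw [eq_top_iff]
      intro a _
      obtain ⟨c, hc⟩ := hval a
      by_cases h0 : c = 0
      · exact hball a (by rw [hc, h0, norm_zero]; exact zero_le_one)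
      have : c⁻¹ • a ∈ F := hball _ (by
        rw [norm_smul, norm_inv, hc, inv_mul_cancel₀ (norm_ne_zero_iff.2 h0)])
      have h2 := F.smul_mem c this
      rwa [smul_inv_smul₀ h0] at h2
    exact Module.Finite.of_fg_top (htop ▸ Submodule.fg_span (Set.finite_range _))
end
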